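/- Let A be an m×n real matrix with nonnegative entries and b ∈ ℝ^m nonnegative, with LIN > 0 the attained optimal value of min{‖x‖₁ : Ax ≥ b, x ≥ 0}. Let δ > 0 and let α be a positive integer. Let x' be feasible with ‖x'‖₁ ≤ (1+δ)·LIN and ‖x'‖₁ ≥ α·(1/δ + 1), and let y' ∈ ℕ^n be an integral feasible solution with ‖y'‖₁ ≤ (1+2δ)·LIN, ‖y'‖₁ ≥ (m+1)·(1/δ + 2), and y'_i ≥ x'_i for all i. Assume x' and y' have exactly the same set of nonzero components, of cardinality K ≤ δ·LIN. Then there exist a feasible x'' and an integral feasible y'' ∈ ℕ^n such that: ‖x''‖₁ ≤ (1+δ)·LIN − α; ‖y''‖₁ ≤ (1+2δ)·LIN − α; x'' and y'' have the same set of nonzero components, of cardinality at most δ·LIN; x''_i ≤ y''_i for all i; and ‖y'' − y'‖₁ ≤ 2(m+1)·(1/δ + 2) + 2m + α·(2/δ + 3). -/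

import Mathlib

open Finset

lemma aux_basic {m n : ℕ} (A : Matrix (Fin m) (Fin n) ℝ) (k : ℕ) :
    ∀ w : Fin n → ℝ, (∀ j, 0 ≤ w j) → (univ.filter (fun j => w j ≠ 0)).card = k →
    ∃ z : Fin n → ℝ, (∀ j, 0 ≤ z j) ∧ A.mulVec z = A.mulVec w ∧ ∑ j, z j ≤ ∑ j, w j ∧
      (univ.filter (fun j => z j ≠ 0)).card ≤ m := by
  induction k using Nat.strong_induction_on with
  | _ k ih =>
  intro w hw hk
  by_cases hkm : k ≤ m
  · exact ⟨w, hw, rfl, le_rfl, hk ▸ hkm⟩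
  push Not at hkm
  set T := univ.filter (fun j => w j ≠ 0) with hT
  have hrel : ∃ v : Fin n → ℝ, A.mulVec v = 0 ∧ (∀ j, w j = 0 → v j = 0) ∧ (∃ j, v j ≠ 0) := by
    have hlt : Module.finrank ℝ (Fin m → ℝ) < Fintype.card T := by
      simp [hk, hkm]
    have hnl : ¬ LinearIndependent ℝ (fun j : T => fun i => A i j.1) := by
      intro h
      have := h.fintype_card_le_finrank
      omega
    rw [Fintype.not_linearIndependent_iff] at hnl
    obtain ⟨g, hg, ⟨j0, hj0⟩⟩ := hnl
    refine ⟨fun j => if h : j ∈ T then g ⟨j, h⟩ else 0, ?_, ?_, ⟨j0.1, ?_⟩⟩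
    · ext i
      have h1 := congrFun hg i
      simp only [Finset.sum_apply, Pi.smul_apply, smul_eq_mul, Pi.zero_apply] at h1
      simp only [Matrix.mulVec, dotProduct, Pi.zero_apply]
      refine Eq.trans ?_ h1
      rw [← Finset.sum_subset (Finset.subset_univ T), ← Finset.sum_coe_sort T]
      · refine Finset.sum_congr rfl fun j _ => ?_
        simp [mul_comm]
      · intro j _ hj
        simp [hj]
    · intro j hj
      have : j ∉ T := by simp [hT, hj]
      simp [this]
    · simpa using hj0
  have hrel2 : ∃ v : Fin n → ℝ, A.mulVec v = 0 ∧ (∀ j, w j = 0 → v j = 0) ∧ (∃ j, v j < 0) ∧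
      ∑ j, v j ≤ 0 := by
    obtain ⟨v, hv1, hv2, hv3⟩ := hrel
    have key : ∀ v : Fin n → ℝ, (∃ j, v j ≠ 0) → ∑ j, v j ≤ 0 → ∃ j, v j < 0 := by
      intro v ⟨j, hj⟩ hs
      by_contra hc
      push Not at hc
      have h0 := le_antisymm hs (Finset.sum_nonneg fun j _ => hc j)
      rw [Finset.sum_eq_zero_iff_of_nonneg (fun j _ => hc j)] at h0
      exact hj (h0 j (mem_univ j))
    rcases le_total (∑ j, v j) 0 with h | h
    · exact ⟨v, hv1, hv2, key v hv3 h, h⟩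
    · have hs : ∑ j, (-v) j ≤ 0 := by simpa using h
      refine ⟨-v, by rw [Matrix.mulVec_neg, hv1, neg_zero], fun j hj => by simp [hv2 j hj],
        key (-v) ?_ hs, hs⟩
      obtain ⟨j, hj⟩ := hv3
      exact ⟨j, by simpa using hj⟩
  obtain ⟨v, hv1, hv2, ⟨j1, hj1⟩, hv4⟩ := hrel2
  obtain ⟨j0, hj0, hmin⟩ := Finset.exists_min_image (univ.filter (fun j => v j < 0))
    (fun j => w j / (-v j)) ⟨j1, by simp [hj1]⟩
  simp only [mem_filter, mem_univ, true_and] at hj0 hmin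
  set t := w j0 / (-v j0) with ht
  have ht0 : 0 ≤ t := div_nonneg (hw _) (by linarith)
  have hw'0 : ∀ j, 0 ≤ (w + t • v) j := by
    intro j
    simp only [Pi.add_apply, Pi.smul_apply, smul_eq_mul]
    by_cases hj : v j < 0
    · have := hmin j hj
      rw [le_div_iff₀ (by linarith)] at this
      linarith
    · push Not at hj
      have := mul_nonneg ht0 hj
      linarith [hw j]
  have hzero : (w + t • v) j0 = 0 := by
    simp only [Pi.add_apply, Pi.smul_apply, smul_eq_mul, ht]
    have : v j0 ≠ 0 := hj0.ne
    field_simp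
    ring
  have hlt : (univ.filter (fun j => (w + t • v) j ≠ 0)).card < k := by
    rw [← hk]
    apply Finset.card_lt_card
    rw [Finset.ssubset_iff_of_subset]
    · refine ⟨j0, ?_, ?_⟩
      · simp only [hT, mem_filter, mem_univ, true_and]
        intro h
        exact hj0.ne (hv2 _ h)
      · simp only [mem_filter, mem_univ, true_and, not_not]
        exact hzero
    · intro j hj
      simp only [hT, mem_filter, mem_univ, true_and] at hj ⊢
      intro h
      apply hj
      simp [h, hv2 j h]
  obtain ⟨z, hz0, hz1, hz2, hz3⟩ := ih _ hlt _ hw'0 rfl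
  refine ⟨z, hz0, ?_, ?_, hz3⟩
  · rw [hz1, Matrix.mulVec_add, Matrix.mulVec_smul, hv1]
    simp
  · refine hz2.trans ?_
    simp only [Pi.add_apply, Pi.smul_apply, smul_eq_mul, Finset.sum_add_distrib,
      ← Finset.mul_sum]
    nlinarith

lemma aux_small {n : ℕ} (f : Fin n → ℝ) (T : Finset (Fin n)) (d : ℕ) :
    d ≤ T.card → ∃ S ⊆ T, S.card = T.card - d ∧
      (T.card : ℝ) * ∑ j ∈ S, f j ≤ S.card * ∑ j ∈ T, f j := by
  induction d with
  | zero => intro _; exact ⟨T, subset_rfl, by simp, le_rfl⟩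
  | succ d ih =>
    intro hd
    obtain ⟨S, hST, hc, hs⟩ := ih (by omega)
    have hne : S.Nonempty := by rw [← Finset.card_pos]; omega
    obtain ⟨j, hj, hmax⟩ := Finset.exists_max_image S f hne
    have hcard := Finset.card_erase_add_one hj
    refine ⟨S.erase j, (Finset.erase_subset _ _).trans hST, by omega, ?_⟩
    have hsum := Finset.sum_erase_add S f hj
    have h1 : ∑ i ∈ S, f i ≤ S.card * f j := by
      have := Finset.sum_le_card_nsmul S f (f j) hmax
      simpa using this
    have hcR : ((S.erase j).card : ℝ) + 1 = S.card := by exact_mod_cast hcard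
    have hSpos : (0 : ℝ) < S.card := by exact_mod_cast hne.card_pos
    have hT0 : (0 : ℝ) ≤ T.card := by positivity
    have he0 : (0 : ℝ) ≤ (S.erase j).card := by positivity
    generalize ((S.erase j).card : ℝ) = e at *
    generalize (S.card : ℝ) = s at *
    generalize (T.card : ℝ) = K at *
    generalize ∑ i ∈ S.erase j, f i = a at *
    generalize ∑ i ∈ S, f i = c at *
    generalize ∑ i ∈ T, f i = q at *
    have h2 : s * a ≤ e * c := by
      have : e = s - 1 := by linarith
      subst this
      have : a = c - f j := by linarith
      subst this
      nlinarith
    have h3 : s * (K * a) ≤ s * (e * q) := by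
      calc s * (K * a) = K * (s * a) := by ring
        _ ≤ K * (e * c) := mul_le_mul_of_nonneg_left h2 hT0
        _ = e * (K * c) := by ring
        _ ≤ e * (s * q) := mul_le_mul_of_nonneg_left hs he0
        _ = s * (e * q) := by ring
    exact le_of_mul_le_mul_left h3 hSpos

lemma aux_between {n : ℕ} (l u : Fin n → ℕ) (hlu : ∀ j, l j ≤ u j) (N : ℕ)
    (h1 : ∑ j, l j ≤ N) : N ≤ ∑ j, u j →
    ∃ y : Fin n → ℕ, (∀ j, l j ≤ y j) ∧ (∀ j, y j ≤ u j) ∧ ∑ j, y j = N := by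
  induction N, h1 using Nat.le_induction with
  | base => intro _; exact ⟨l, fun _ => le_rfl, hlu, rfl⟩
  | succ N hN ih =>
    intro h
    obtain ⟨y, hy1, hy2, hy3⟩ := ih (by omega)
    have : ∃ j, y j < u j := by
      by_contra hc
      push Not at hc
      have := Finset.sum_le_sum (fun j (_ : j ∈ univ) => hc j)
      omega
    obtain ⟨j, hj⟩ := this
    refine ⟨fun i => y i + if i = j then 1 else 0, fun i => (hy1 i).trans (by simp), fun i => ?_, ?_⟩
    · by_cases hi : i = j
      · subst hi; simpa using hj
      · simpa [hi] using hy2 i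
    · simp [Finset.sum_add_distrib, hy3]

lemma aux_between2 {n : ℕ} (l u : Fin n → ℕ) (hlu : ∀ j, l j ≤ u j) (N : ℕ)
    (h1 : ∑ j, l j ≤ N) :
    ∃ y : Fin n → ℕ, (∀ j, l j ≤ y j) ∧ (∀ j, y j ≤ u j) ∧ ∑ j, y j ≤ N ∧
      (∑ j, y j = ∑ j, u j ∨ ∑ j, y j = N) := by
  rcases le_total N (∑ j, u j) with h | h
  · obtain ⟨y, a, b, c⟩ := aux_between l u hlu N h1 h
    exact ⟨y, a, b, c.le, Or.inr c⟩
  · exact ⟨u, hlu, fun _ => le_rfl, h, Or.inl rfl⟩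

lemma aux_ceil {n : ℕ} (z : Fin n → ℝ) (hz : ∀ j, 0 ≤ z j) :
    ∑ j, (⌈z j⌉₊ : ℝ) ≤ ∑ j, z j + (univ.filter (fun j => z j ≠ 0)).card := by
  rw [Finset.card_filter]
  push_cast
  rw [← Finset.sum_add_distrib]
  refine Finset.sum_le_sum fun j _ => ?_
  by_cases h : z j = 0
  · simp [h]
  · simp only [h, ne_eq, not_false_eq_true, if_true]
    exact (Nat.ceil_lt_add_one (hz j)).le

lemma aux_mono {m n : ℕ} (A : Matrix (Fin m) (Fin n) ℝ) (hA : ∀ i j, 0 ≤ A i j)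
    (x y : Fin n → ℝ) (h : ∀ j, x j ≤ y j) (i : Fin m) : A.mulVec x i ≤ A.mulVec y i := by
  simp only [Matrix.mulVec, dotProduct]
  exact Finset.sum_le_sum fun j _ => mul_le_mul_of_nonneg_left (h j) (hA i j)

lemma aux_c (L δ α t : ℝ) (hL : 0 < L) (hδ : 0 < δ) (hα : 0 < α) (ht : L ≤ t)
    (ht2 : t ≤ (1 + δ) * L) (hαL : α ≤ δ * L) :
    ∃ c : ℝ, 0 ≤ c ∧ c ≤ 1 ∧ (1 - c) * t + c * L ≤ (1 + δ) * L - α ∧ c * L ≤ α / δ ∧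
      (c = 1 → α = δ * L) := by
  by_cases h : t ≤ (1 + δ) * L - α
  · exact ⟨0, le_rfl, by norm_num, by linarith, by rw [zero_mul]; positivity, by norm_num⟩
  push Not at h
  have htL : 0 < t - L := by nlinarith
  refine ⟨(t - (1 + δ) * L + α) / (t - L), div_nonneg (by linarith) htL.le, ?_, ?_, ?_, ?_⟩
  · rw [div_le_one htL]; nlinarith
  · have : (t - (1 + δ) * L + α) / (t - L) * (t - L) = t - (1 + δ) * L + α :=
      div_mul_cancel₀ _ htL.ne'
    linarith
  · rw [div_mul_eq_mul_div, div_le_div_iff₀ htL hδ]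
    nlinarith [mul_nonneg (sub_nonneg.2 hαL) (sub_nonneg.2 ht2)]
  · intro hc
    rw [div_eq_one_iff_eq htL.ne'] at hc
    linarith

set_option maxHeartbeats 1000000 in
theorem algorithm4_correct
    (m n : ℕ) (hm : 0 < m) (hn : 0 < n)
    (A : Matrix (Fin m) (Fin n) ℝ) (hA : ∀ i j, 0 ≤ A i j)
    (b : Fin m → ℝ) (hb : ∀ i, 0 ≤ b i)
    (xOPT : Fin n → ℝ)
    (hxOPTnonneg : ∀ j, 0 ≤ xOPT j)
    (hxOPTfeas : ∀ i, b i ≤ A.mulVec xOPT i)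
    (hxOPTopt : ∀ x : Fin n → ℝ, (∀ j, 0 ≤ x j) → (∀ i, b i ≤ A.mulVec x i) →
      ∑ j, |xOPT j| ≤ ∑ j, |x j|)
    (LIN : ℝ) (hLIN : LIN = ∑ j, |xOPT j|) (hLINpos : 0 < LIN)
    (δ : ℝ) (hδ : 0 < δ) (α : ℕ) (hα : 0 < α)
    (x' : Fin n → ℝ)
    (hx'nonneg : ∀ j, 0 ≤ x' j)
    (hx'feas : ∀ i, b i ≤ A.mulVec x' i)
    (hx'val : ∑ j, |x' j| ≤ (1 + δ) * LIN)
    (hx'big : (α : ℝ) * (1 / δ + 1) ≤ ∑ j, |x' j|)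
    (y' : Fin n → ℕ)
    (hy'feas : ∀ i, b i ≤ A.mulVec (fun j => (y' j : ℝ)) i)
    (hy'val : ∑ j, (y' j : ℝ) ≤ (1 + 2 * δ) * LIN)
    (hy'big : ((m : ℝ) + 1) * (1 / δ + 2) ≤ ∑ j, (y' j : ℝ))
    (hy'ge : ∀ j, x' j ≤ (y' j : ℝ))
    (hsupp : ∀ j, x' j ≠ 0 ↔ y' j ≠ 0)
    (K : ℕ) (hK : (Finset.univ.filter (fun j => y' j ≠ 0)).card = K)
    (hKle : (K : ℝ) ≤ δ * LIN) :
    ∃ x'' : Fin n → ℝ, ∃ y'' : Fin n → ℕ,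
      (∀ j, 0 ≤ x'' j) ∧ (∀ i, b i ≤ A.mulVec x'' i) ∧
      (∀ i, b i ≤ A.mulVec (fun j => (y'' j : ℝ)) i) ∧
      ∑ j, |x'' j| ≤ (1 + δ) * LIN - α ∧
      ∑ j, (y'' j : ℝ) ≤ (1 + 2 * δ) * LIN - α ∧
      (∀ j, x'' j ≠ 0 ↔ y'' j ≠ 0) ∧
      ((Finset.univ.filter (fun j => y'' j ≠ 0)).card : ℝ) ≤ δ * LIN ∧
      (∀ j, x'' j ≤ (y'' j : ℝ)) ∧
      ∑ j, |(y'' j : ℝ) - (y' j : ℝ)| ≤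
        2 * ((m : ℝ) + 1) * (1 / δ + 2) + 2 * m + (α : ℝ) * (2 / δ + 3) := by
  have hαR : (0 : ℝ) < α := by exact_mod_cast hα
  have habs : ∀ x : Fin n → ℝ, (∀ j, 0 ≤ x j) → ∑ j, |x j| = ∑ j, x j := fun x hx =>
    Finset.sum_congr rfl fun j _ => abs_of_nonneg (hx j)
  have hLt : LIN ≤ ∑ j, x' j := by
    rw [hLIN, ← habs x' hx'nonneg]; exact hxOPTopt x' hx'nonneg hx'feas
  rw [habs x' hx'nonneg] at hx'val hx'big
  rw [habs xOPT hxOPTnonneg] at hLIN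
  have hαL : (α : ℝ) ≤ δ * LIN := by
    have h1 : (α : ℝ) * (1 / δ + 1) ≤ (1 + δ) * LIN := hx'big.trans hx'val
    have h2 : (α : ℝ) * (1 / δ + 1) * δ = α * (1 + δ) := by field_simp
    have h3 := mul_le_mul_of_nonneg_right h1 hδ.le
    rw [h2] at h3
    have : (1 + δ) * α ≤ (1 + δ) * (δ * LIN) := by linarith
    exact le_of_mul_le_mul_left this (by linarith)
  have hmL : (m : ℝ) + 1 ≤ δ * LIN := by
    have h1 := hy'big.trans hy'val
    have h2 : ((m : ℝ) + 1) * (1 / δ + 2) * δ = (m + 1) * (1 + 2 * δ) := by field_simp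
    have h3 := mul_le_mul_of_nonneg_right h1 hδ.le
    rw [h2] at h3
    have : (1 + 2 * δ) * ((m : ℝ) + 1) ≤ (1 + 2 * δ) * (δ * LIN) := by linarith
    exact le_of_mul_le_mul_left this (by linarith)
  obtain ⟨c, hc0, hc1, hcval, hcL, hceq⟩ :=
    aux_c LIN δ α _ hLINpos hδ hαR hLt hx'val hαL
  have hDpos : 0 ≤ ((m : ℝ) + 1) * (1 / δ + 2) := by positivity
  have hexp : (α : ℝ) * (2 / δ + 3) = 2 * (α / δ) + 3 * α := by ring
  rcases hc1.eq_or_lt with hc | hc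
  · -- c = 1
    have hαeq := hceq hc
    obtain ⟨z, hz0, hzA, hzs, hzc⟩ := aux_basic A _ xOPT hxOPTnonneg rfl
    have hzcR : ((univ.filter (fun j => z j ≠ 0)).card : ℝ) ≤ m := by exact_mod_cast hzc
    have hceil := aux_ceil z hz0
    have hzle : ∀ j, z j ≤ (⌈z j⌉₊ : ℝ) := fun j => Nat.le_ceil _
    have hzfeas : ∀ i, b i ≤ A.mulVec z i := fun i => by rw [hzA]; exact hxOPTfeas i
    have hiff : ∀ j, z j ≠ 0 ↔ ⌈z j⌉₊ ≠ 0 := fun j => by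
      rw [ne_eq, ne_eq, Nat.ceil_eq_zero, not_iff_not]
      exact ⟨fun h => h.le, fun h => le_antisymm h (hz0 j)⟩
    refine ⟨z, fun j => ⌈z j⌉₊, hz0, hzfeas, fun i => (hzfeas i).trans
      (aux_mono A hA _ _ hzle i), ?_, ?_, hiff, ?_, hzle, ?_⟩
    · rw [habs z hz0]; linarith
    · linarith
    · simp only [← hiff]; linarith
    · have h1 : ∑ j, |(⌈z j⌉₊ : ℝ) - (y' j : ℝ)| ≤ ∑ j, ((⌈z j⌉₊ : ℝ) + (y' j : ℝ)) :=
        Finset.sum_le_sum fun j _ => by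
          rw [abs_le]
          have := Nat.cast_nonneg (α := ℝ) ⌈z j⌉₊
          have := Nat.cast_nonneg (α := ℝ) (y' j)
          constructor <;> linarith
      rw [Finset.sum_add_distrib] at h1
      have : (α : ℝ) / δ = LIN := by rw [hαeq]; field_simp
      rw [hexp, this]
      nlinarith [mul_pos hδ hLINpos]
  -- c < 1
  set T := univ.filter (fun j => y' j ≠ 0) with hT
  have hYT : ∑ j ∈ T, (y' j : ℝ) = ∑ j, (y' j : ℝ) := by
    apply Finset.sum_subset (Finset.subset_univ _)
    intro j _ hj
    simpa [hT] using hj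
  have hS : ∃ S ⊆ T, ∑ j ∈ S, (y' j : ℝ) ≤ ((m : ℝ) + 1) * (1 / δ + 2) ∧
      (K : ℝ) + m ≤ δ * LIN + S.card := by
    by_cases hs : (K : ℝ) + m ≤ δ * LIN
    · exact ⟨∅, by simp, by simpa using hDpos, by simpa using hs⟩
    push Not at hs
    set F := ⌊δ * LIN⌋₊ with hF
    have hF1 : (F : ℝ) ≤ δ * LIN := Nat.floor_le (by positivity)
    have hF2 : δ * LIN < F + 1 := Nat.lt_floor_add_one _
    have hF3 : m + 1 ≤ F := Nat.le_floor (by exact_mod_cast hmL)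
    have hF4 : K ≤ F := Nat.le_floor hKle
    have hF5 : F < K + m := by
      have : (F : ℝ) < ((K + m : ℕ) : ℝ) := by push_cast; linarith
      exact_mod_cast this
    obtain ⟨S, hST, hSc, hSs⟩ := aux_small (fun j => (y' j : ℝ)) T (F - m) (by omega)
    have hSc' : S.card + F = K + m := by omega
    have hScR : (S.card : ℝ) + F = K + m := by exact_mod_cast hSc'
    refine ⟨S, hST, ?_, by linarith⟩
    rw [hYT, hK] at hSs
    have hKpos : (0 : ℝ) < K := by
      have : 0 < K := by omega
      exact_mod_cast this
    have hs1 : (S.card : ℝ) ≤ K + (m + 1 - δ * LIN) := by linarith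
    have h0 : (K : ℝ) * ∑ j ∈ S, (y' j : ℝ) ≤ S.card * ((1 + 2 * δ) * LIN) :=
      hSs.trans (mul_le_mul_of_nonneg_left hy'val (by positivity))
    have h1 : (S.card : ℝ) * (δ * LIN) ≤ K * (m + 1) := by
      have := mul_le_mul_of_nonneg_right hs1 (by positivity : 0 ≤ δ * LIN)
      nlinarith [mul_nonneg (sub_nonneg.2 hKle) (sub_nonneg.2 hmL)]
    have h2 : (S.card : ℝ) * ((1 + 2 * δ) * LIN) = S.card * (δ * LIN) * (1 / δ + 2) := by
      field_simp
    rw [h2] at h0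
    have h3 := mul_le_mul_of_nonneg_right h1 (by positivity : 0 ≤ 1 / δ + 2)
    refine le_of_mul_le_mul_left ?_ hKpos
    linarith
  obtain ⟨S, hST, hSs, hSc⟩ := hS
  set xf : Fin n → ℝ := fun j => if j ∈ S then 0 else (1 - c) * x' j with hxf
  set w : Fin n → ℝ := fun j => c * xOPT j + if j ∈ S then (1 - c) * x' j else 0 with hw
  have h1c : 0 < 1 - c := by linarith
  have hxf0 : ∀ j, 0 ≤ xf j := fun j => by
    simp only [hxf]; split_ifs
    · exact le_rfl
    · exact mul_nonneg h1c.le (hx'nonneg j)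
  have hw0 : ∀ j, 0 ≤ w j := fun j => by
    have := mul_nonneg hc0 (hxOPTnonneg j)
    have := mul_nonneg h1c.le (hx'nonneg j)
    simp only [hw]; split_ifs <;> linarith
  have hxw : xf + w = (1 - c) • x' + c • xOPT := by
    ext j
    simp only [hxf, hw, Pi.add_apply, Pi.smul_apply, smul_eq_mul]
    split_ifs <;> ring
  have hxws : ∑ j, xf j + ∑ j, w j = (1 - c) * ∑ j, x' j + c * LIN := by
    rw [hLIN, Finset.mul_sum, Finset.mul_sum, ← Finset.sum_add_distrib, ← Finset.sum_add_distrib]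
    exact Finset.sum_congr rfl fun j _ => by simpa using congrFun hxw j
  have hws : ∑ j, w j ≤ α / δ + ∑ j ∈ S, (y' j : ℝ) := by
    have e : ∑ j, w j = c * LIN + ∑ j ∈ S, (1 - c) * x' j := by
      simp only [hw, Finset.sum_add_distrib, hLIN, Finset.mul_sum]
      simp
    have : ∑ j ∈ S, (1 - c) * x' j ≤ ∑ j ∈ S, (y' j : ℝ) :=
      Finset.sum_le_sum fun j _ => by
        have := mul_nonneg hc0 (hx'nonneg j)
        have := hy'ge j
        linarith
    linarith
  obtain ⟨z, hz0, hzA, hzs, hzc⟩ := aux_basic A _ w hw0 rfl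
  have hzcR : ((univ.filter (fun j => z j ≠ 0)).card : ℝ) ≤ m := by exact_mod_cast hzc
  have hceil := aux_ceil z hz0
  have hx0 : ∀ j, 0 ≤ (xf + z) j := fun j => add_nonneg (hxf0 j) (hz0 j)
  have hxfeas : ∀ i, b i ≤ A.mulVec (xf + z) i := fun i => by
    rw [Matrix.mulVec_add, hzA, ← Matrix.mulVec_add, hxw, Matrix.mulVec_add, Matrix.mulVec_smul,
      Matrix.mulVec_smul]
    simp only [Pi.add_apply, Pi.smul_apply, smul_eq_mul]
    have := mul_le_mul_of_nonneg_left (hx'feas i) h1c.le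
    have := mul_le_mul_of_nonneg_left (hxOPTfeas i) hc0
    linarith
  have hxs : ∑ j, (xf + z) j ≤ (1 + δ) * LIN - α := by
    simp only [Pi.add_apply, Finset.sum_add_distrib]; linarith
  have hxcard : ((univ.filter (fun j => (xf + z) j ≠ 0)).card : ℝ) ≤ δ * LIN := by
    have hsub : univ.filter (fun j => (xf + z) j ≠ 0) ⊆
        (T \ S) ∪ univ.filter (fun j => z j ≠ 0) := by
      intro j hj
      simp only [mem_filter, mem_univ, true_and, mem_union, mem_sdiff, hT, Pi.add_apply] at hj ⊢
      by_contra hcon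
      push Not at hcon
      obtain ⟨h1, h2⟩ := hcon
      apply hj
      rw [h2, add_zero]
      simp only [hxf]
      split_ifs with hjS
      · rfl
      · have : x' j = 0 := by
          by_contra hx
          exact hjS (h1 ((hsupp j).1 hx))
        rw [this, mul_zero]
    have h1 := (Finset.card_le_card hsub).trans (Finset.card_union_le _ _)
    have h2 := Finset.card_sdiff_add_card_eq_card hST
    have h3 : (univ.filter (fun j => (xf + z) j ≠ 0)).card + S.card ≤ K + m := by omega
    have h4 : ((univ.filter (fun j => (xf + z) j ≠ 0)).card : ℝ) + S.card ≤ K + m := by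
      exact_mod_cast h3
    linarith
  set u : Fin n → ℕ := fun j => (if j ∈ S then 0 else y' j) + ⌈z j⌉₊ with hu
  have hlu : ∀ j, ⌈(xf + z) j⌉₊ ≤ u j := fun j => by
    apply Nat.ceil_le.2
    simp only [hu, hxf, Pi.add_apply]
    push_cast
    refine add_le_add ?_ (Nat.le_ceil _)
    split_ifs
    · simp
    · have := mul_nonneg hc0 (hx'nonneg j)
      have := hy'ge j
      linarith
  have hlceil := aux_ceil (xf + z) hx0
  have htgt : 0 ≤ (1 + 2 * δ) * LIN - α := by nlinarith
  set N := ⌊(1 + 2 * δ) * LIN - α⌋₊ with hN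
  have hlN : ∑ j, ⌈(xf + z) j⌉₊ ≤ N := by
    apply Nat.le_floor
    push_cast
    linarith
  obtain ⟨y, hly, hyu, hyN, hyeq⟩ := aux_between2 _ u hlu N hlN
  have hxy : ∀ j, (xf + z) j ≤ (y j : ℝ) := fun j =>
    (Nat.le_ceil _).trans (by exact_mod_cast hly j)
  have hiff : ∀ j, (xf + z) j ≠ 0 ↔ y j ≠ 0 := fun j => by
    rw [ne_eq, ne_eq, not_iff_not]
    constructor
    · intro h
      have h1 : xf j = 0 := by have := hxf0 j; have := hz0 j; simp only [Pi.add_apply] at h; linarith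
      have h2 : z j = 0 := by have := hxf0 j; have := hz0 j; simp only [Pi.add_apply] at h; linarith
      have h3 : u j = 0 := by
        simp only [hu, h2, Nat.ceil_zero, add_zero]
        split_ifs with hjS
        · rfl
        · simp only [hxf, hjS, if_false, mul_eq_zero, h1c.ne', false_or] at h1
          by_contra hy
          exact (hsupp j).2 hy h1
      have := hyu j
      omega
    · intro h
      have h1 := hxy j
      rw [h, Nat.cast_zero] at h1
      exact le_antisymm h1 (hx0 j)
  refine ⟨xf + z, y, hx0, hxfeas, fun i => (hxfeas i).trans (aux_mono A hA _ _ hxy i), ?_, ?_,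
    hiff, ?_, hxy, ?_⟩
  · rw [habs _ hx0]; exact hxs
  · have h1 : (∑ j, (y j : ℝ)) ≤ N := by exact_mod_cast hyN
    exact h1.trans (Nat.floor_le htgt)
  · simp only [← hiff]; exact hxcard
  · have hpt : ∀ j, |(y j : ℝ) - (y' j : ℝ)| ≤
        ((u j : ℝ) - y j) + ((if j ∈ S then (y' j : ℝ) else 0) + ⌈z j⌉₊) := fun j => by
      have h1 : (y j : ℝ) ≤ u j := by exact_mod_cast hyu j
      have h2 := Nat.cast_nonneg (α := ℝ) ⌈z j⌉₊
      have h3 := Nat.cast_nonneg (α := ℝ) (y' j)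
      have h4 : (u j : ℝ) = (if j ∈ S then 0 else (y' j : ℝ)) + ⌈z j⌉₊ := by
        simp only [hu]; push_cast; rfl
      rw [abs_le]
      split_ifs at h4 ⊢ <;> constructor <;> linarith
    have hsum := Finset.sum_le_sum fun j (_ : j ∈ univ) => hpt j
    rw [Finset.sum_add_distrib, Finset.sum_add_distrib, Finset.sum_sub_distrib,
      Finset.sum_ite_mem, Finset.univ_inter] at hsum
    have husum : ∑ j, (u j : ℝ) + ∑ j ∈ S, (y' j : ℝ) = ∑ j, (y' j : ℝ) + ∑ j, (⌈z j⌉₊ : ℝ) := by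
      have e : ∑ j ∈ S, (y' j : ℝ) = ∑ j, if j ∈ S then (y' j : ℝ) else 0 := by
        rw [Finset.sum_ite_mem, Finset.univ_inter]
      rw [e, ← Finset.sum_add_distrib, ← Finset.sum_add_distrib]
      refine Finset.sum_congr rfl fun j _ => ?_
      simp only [hu]
      split_ifs <;> push_cast <;> ring
    rw [hexp]
    rcases hyeq with h | h
    · have hR : ∑ j, (y j : ℝ) = ∑ j, (u j : ℝ) := by exact_mod_cast h
      have : 0 ≤ (α : ℝ) / δ := by positivity
      have : (0 : ℝ) ≤ m := by positivity
      linarith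
    · have hR : ∑ j, (y j : ℝ) = N := by exact_mod_cast h
      have hY : ∑ j, (y' j : ℝ) ≤ N + α := by
        have h1 : ∑ j, y' j - α ≤ N := by
          rcases le_total (∑ j, y' j) α with h2 | h2
          · omega
          · apply Nat.le_floor
            rw [Nat.cast_sub h2]
            push_cast
            linarith
        have h2 : ∑ j, y' j ≤ N + α := by omega
        exact_mod_cast h2
      linarith
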